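/- arXiv:math/0305116 — 2 statements merged into one kernel-verified Lean document; each statement's English description precedes it below -/
import Mathlib

section
/- Let P be a polynomial with integer coefficients of degree m ≤ 3 with P(0) = 1, such that all roots of P (over ℝ) are real and negative, P splits over ℝ, and P is reciprocal, i.e. its coefficients satisfy a_i = a_{m−i} for 0 ≤ i ≤ m where P(t) = ∑_{i=0}^m a_i t^i. Then there exist ε_1, ε_2 ∈ {0, 1} and an integer a ≥ 2 such that P(t) = (1 + t)^{ε_1} (1 + a t + t²)^{ε_2}. -/
open Polynomial

theorem quad_aux (P : Polynomial ℤ) (hP : P ≠ 0)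
    (hsplit : Polynomial.Splits (P.map (Int.castRingHom ℝ)))
    (hroots : ∀ r ∈ (P.map (Int.castRingHom ℝ)).roots, r < 0) (a : ℤ)
    (hd : (1 + C a * X + X ^ 2 : Polynomial ℤ) ∣ P) : 2 ≤ a := by
  have hP' : P.map (Int.castRingHom ℝ) ≠ 0 :=
    (Polynomial.map_ne_zero_iff (RingHom.injective_int _)).2 hP
  have hd' := Polynomial.map_dvd (Int.castRingHom ℝ) hd
  have hs := hsplit.of_dvd hP' hd'
  have hdeg : ((1 + C a * X + X ^ 2 : Polynomial ℤ).map (Int.castRingHom ℝ)).degree = 2 := by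
    simp only [Polynomial.map_add, Polynomial.map_mul, Polynomial.map_pow, Polynomial.map_one,
      Polynomial.map_C, Polynomial.map_X]
    compute_degree!
  obtain ⟨r, hr⟩ := hs.exists_eval_eq_zero (by rw [hdeg]; decide)
  have hr0 : r < 0 := by
    apply hroots
    rw [Polynomial.mem_roots hP']
    exact Polynomial.IsRoot.dvd hr hd'
  simp at hr
  have : (2 : ℝ) ≤ a := by
    by_contra! h
    nlinarith [sq_nonneg (r + 1), mul_pos_of_neg_of_neg hr0 (sub_neg.2 h)]
  exact_mod_cast this

/-- A reciprocal integer polynomial of degree at most 3 with constant term 1 whose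
real roots are all negative and which splits over `ℝ` has the form
`(1 + t)^ε₁ (1 + a t + t²)^ε₂` with `ε₁, ε₂ ∈ {0, 1}` and `a ∈ ℤ`, `a ≥ 2`. -/
theorem reciprocal_deg_le_three_classification
    (P : Polynomial ℤ) (hdeg : P.natDegree ≤ 3) (h0 : P.coeff 0 = 1)
    (hsplit : Polynomial.Splits (P.map (Int.castRingHom ℝ)))
    (hroots : ∀ r ∈ (P.map (Int.castRingHom ℝ)).roots, r < 0)
    (hrec : ∀ i ≤ P.natDegree, P.coeff i = P.coeff (P.natDegree - i)) :
    ∃ (ε₁ ε₂ : ℕ), ε₁ ≤ 1 ∧ ε₂ ≤ 1 ∧ ∃ a : ℤ, 2 ≤ a ∧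
      P = (1 + Polynomial.X) ^ ε₁ *
          (1 + Polynomial.C a * Polynomial.X + Polynomial.X ^ 2) ^ ε₂ := by
  have hP : P ≠ 0 := by rintro rfl; simp at h0
  have hsum := P.as_sum_range_C_mul_X_pow
  have key := quad_aux P hP hsplit hroots
  have h0' := hrec 0 (Nat.zero_le _)
  have h1' := hrec 1
  generalize hn : P.natDegree = n at *
  interval_cases n
  · refine ⟨0, 0, by simp, by simp, 2, le_rfl, ?_⟩
    rw [hsum]; simp [h0]
  · refine ⟨1, 0, by simp, by simp, 2, le_rfl, ?_⟩
    have h1 : P.coeff 1 = 1 := by simpa [h0] using h0'.symm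
    rw [hsum]; simp [Finset.sum_range_succ, h0, h1]
  · have h2 : P.coeff 2 = 1 := by simpa [h0] using h0'.symm
    have e : P = (1 + X) ^ 0 * (1 + C (P.coeff 1) * X + X ^ 2) ^ 1 := by
      conv_lhs => rw [hsum]
      simp [Finset.sum_range_succ, h0, h2]
    exact ⟨0, 1, by simp, by simp, P.coeff 1, key _ ⟨1, by rw [mul_one]; simpa using e⟩, e⟩
  · have h3 : P.coeff 3 = 1 := by simpa [h0] using h0'.symm
    have h2 : P.coeff 2 = P.coeff 1 := by simpa using (h1' (by norm_num)).symm
    have e : P = (1 + X) ^ 1 * (1 + C (P.coeff 1 - 1) * X + X ^ 2) ^ 1 := by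
      conv_lhs => rw [hsum]
      simp [Finset.sum_range_succ, h0, h2, h3]
      ring
    exact ⟨1, 1, by simp, by simp, P.coeff 1 - 1, key _ ⟨1 + X, by rw [mul_comm]; simpa using e⟩, e⟩
end

section
/- Let Q be a polynomial with integer coefficients of degree n ≤ 3 with Q(0) = 1, such that all roots of Q (over ℝ) are real and positive, Q splits over ℝ, and Q is skew-reciprocal, i.e. writing Q(t) = ∑_{j=0}^n (−1)^j b_j t^j one has b_j = b_{n−j} for 0 ≤ j ≤ n. Then there exist δ_1, δ_2 ∈ {0, 1} and an integer b ≥ 2 such that Q(t) = (1 − t)^{δ_1} (1 − b t + t²)^{δ_2}. -/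
open Polynomial

lemma quad_aux_s9 (Q : Polynomial ℤ) (hQ : Q ≠ 0) (b : ℤ)
    (hd : (1 - Polynomial.C b * Polynomial.X + Polynomial.X ^ 2) ∣ Q)
    (hsplit : Polynomial.Splits ((Q.map (Int.castRingHom ℝ)).map (RingHom.id ℝ)))
    (hroots : ∀ r ∈ (Q.map (Int.castRingHom ℝ)).roots, 0 < r) : 2 ≤ b := by
  rw [Polynomial.map_id] at hsplit
  have hQ' : Q.map (Int.castRingHom ℝ) ≠ 0 :=
    (Polynomial.map_ne_zero_iff (RingHom.injective_int _)).2 hQ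
  have hd' := Polynomial.map_dvd (Int.castRingHom ℝ) hd
  have hs := hsplit.of_dvd hQ' hd'
  have hdeg : ((1 - C b * X + X ^ 2 : ℤ[X]).map (Int.castRingHom ℝ)).degree = 2 := by
    have : ((1 - C b * X + X ^ 2 : ℤ[X]).map (Int.castRingHom ℝ))
        = C 1 * X ^ 2 + C (-(b : ℝ)) * X + C 1 := by
      simp
      ring
    rw [this, degree_quadratic one_ne_zero]
  obtain ⟨r, hr⟩ := hs.exists_eval_eq_zero (by rw [hdeg]; decide)
  have hpos := hroots r (by
    rw [mem_roots hQ']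
    exact IsRoot.dvd hr hd')
  simp at hr
  have : (2 : ℝ) ≤ b := by
    by_contra h
    nlinarith [sq_nonneg (r - 1), mul_pos hpos (sub_pos.2 (not_le.1 h))]
  exact_mod_cast this

theorem skew_reciprocal_deg_le_three_classification
    (Q : Polynomial ℤ) (hdeg : Q.natDegree ≤ 3) (h0 : Q.coeff 0 = 1)
    (hsplit : Polynomial.Splits ((Q.map (Int.castRingHom ℝ)).map (RingHom.id ℝ)))
    (hroots : ∀ r ∈ (Q.map (Int.castRingHom ℝ)).roots, 0 < r)
    (hskew : ∀ j ≤ Q.natDegree,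
      (-1 : ℤ) ^ j * Q.coeff j = (-1 : ℤ) ^ (Q.natDegree - j) * Q.coeff (Q.natDegree - j)) :
    ∃ (δ₁ δ₂ : ℕ), δ₁ ≤ 1 ∧ δ₂ ≤ 1 ∧ ∃ b : ℤ, 2 ≤ b ∧
      Q = (1 - Polynomial.X) ^ δ₁ *
          (1 - Polynomial.C b * Polynomial.X + Polynomial.X ^ 2) ^ δ₂ := by
  have hQ : Q ≠ 0 := by
    rintro rfl
    simp at h0
  have hsum := Q.as_sum_range_C_mul_X_pow
  obtain hn | hn | hn | hn : Q.natDegree = 0 ∨ Q.natDegree = 1 ∨ Q.natDegree = 2 ∨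
      Q.natDegree = 3 := by omega
  all_goals
    rw [hn] at hskew hsum
    simp only [Finset.sum_range_succ, Finset.sum_range_zero] at hsum
    have e0 := hskew 0 (by omega)
    norm_num [h0] at e0
  · exact ⟨0, 0, by simp, by simp, 2, le_rfl, by rw [hsum]; simp [h0]⟩
  · refine ⟨1, 0, by simp, by simp, 2, le_rfl, ?_⟩
    have : Q.coeff 1 = -1 := by linarith
    rw [hsum]; simp [h0, this]; ring
  · have h2 : Q.coeff 2 = 1 := by linarith
    have key : Q = 1 - C (-Q.coeff 1) * X + X ^ 2 := by
      conv_lhs => rw [hsum]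
      simp [h0, h2]
    exact ⟨0, 1, by simp, by simp, -Q.coeff 1,
      quad_aux_s9 Q hQ _ (dvd_of_eq key.symm) hsplit hroots, by simpa using key⟩
  · have h3 : Q.coeff 3 = -1 := by linarith
    have e1 := hskew 1 (by omega)
    norm_num at e1
    have h2 : Q.coeff 2 = - Q.coeff 1 := by linarith
    have key : Q = (1 - X) * (1 - C (-(Q.coeff 1 + 1)) * X + X ^ 2) := by
      conv_lhs => rw [hsum]
      simp [h0, h2, h3]
      ring
    exact ⟨1, 1, by simp, by simp, -(Q.coeff 1 + 1),
      quad_aux_s9 Q hQ _ (Dvd.intro_left _ key.symm) hsplit hroots, by simpa using key⟩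
end
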